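/- Fix n ≥ 1 and set Q_i = Σ_{j=0}^{i} I^{n−j} J^j ⊆ R for i = 0,…,n. Then for every 1 ≤ i ≤ n there is an isomorphism of graded R-modules Q_i/Q_{i−1} ≅ I^{n−i}J^i / I^{n−i+1}J^i. -/

import Mathlib

/-! Core definitions: depth via local cohomology at the maximal homogeneous ideal,
Castelnuovo–Mumford regularity via graded free resolutions, gradings on
subquotients of polynomial rings.  -/

open MvPolynomial

noncomputable section

namespace PaperHTT

variable (k : Type) [Field k]

/-- A polynomial is homogeneous of degree `e : ℤ` (it must vanish in negative degrees). -/
def homogZ {σ : Type} (p : MvPolynomial σ k) (e : ℤ) : Prop :=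
  p = 0 ∨ (0 ≤ e ∧ p.IsHomogeneous e.toNat)

/-- The maximal homogeneous ideal `(x_1, …, x_r)` of a polynomial ring. -/
def maxHomIdeal (σ : Type) : Ideal (MvPolynomial σ k) :=
  Ideal.span (Set.range MvPolynomial.X)

/-- The depth of a module over a polynomial ring with respect to the maximal homogeneous
ideal: the least `i` such that the `i`-th local cohomology is non-vanishing. -/
def depthM {σ : Type} (M : ModuleCat (MvPolynomial σ k)) : ℕ :=
  sInf {i : ℕ | Nontrivial ((localCohomology (maxHomIdeal k σ) i).obj M)}

/-- The subquotient `p/q` of a polynomial ring, for ideals `q ≤ p`. -/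
abbrev subQuot {σ : Type} (p q : Ideal (MvPolynomial σ k)) : Type :=
  ↥p ⧸ (Submodule.comap p.subtype q)

/-- The degree-`t` graded piece of `p/q`: the image of the homogeneous elements of
degree `t` of `p`. -/
def subQuotGr {σ : Type} (p q : Ideal (MvPolynomial σ k)) (t : ℤ) :
    AddSubgroup (subQuot k p q) :=
  AddSubgroup.closure
    {x | ∃ f : p, homogZ k (f : MvPolynomial σ k) t ∧ x = Submodule.Quotient.mk f}

/-- The degree-`t` graded piece of the quotient ring `P/Q`. -/
def quotGr {σ : Type} (Q : Ideal (MvPolynomial σ k)) (t : ℤ) :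
    AddSubgroup (MvPolynomial σ k ⧸ Q) :=
  AddSubgroup.closure {x | ∃ f, homogZ k f t ∧ x = Ideal.Quotient.mk Q f}

/-- The degree-`t` graded piece of an ideal `p`, viewed as a module. -/
def idealGr {σ : Type} (p : Ideal (MvPolynomial σ k)) (t : ℤ) : AddSubgroup ↥p :=
  AddSubgroup.closure {x : p | homogZ k (x : MvPolynomial σ k) t}

/-- A finite graded free resolution of a module `M` over a polynomial ring,
with respect to a grading `gr` of `M`: `F_i` is free of rank `rk i`, with basis elements
of (twisted) degrees `tw i l`, the differentials and augmentation are graded of degree `0`,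
and the complex `⋯ → F_1 → F_0 → M → 0` is exact. -/
structure GradedFreeRes (σ : Type) (M : Type) [AddCommGroup M]
    [Module (MvPolynomial σ k) M] (gr : ℤ → AddSubgroup M) where
  rk : ℕ → ℕ
  tw : (i : ℕ) → Fin (rk i) → ℤ
  bdd : ∃ N, ∀ i, N ≤ i → rk i = 0
  aug : (Fin (rk 0) → MvPolynomial σ k) →ₗ[MvPolynomial σ k] M
  d : (i : ℕ) →
    ((Fin (rk (i + 1)) → MvPolynomial σ k) →ₗ[MvPolynomial σ k]
      (Fin (rk i) → MvPolynomial σ k))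
  aug_surj : Function.Surjective aug
  exact_zero : LinearMap.range (d 0) = LinearMap.ker aug
  exact_succ : ∀ i, LinearMap.range (d (i + 1)) = LinearMap.ker (d i)
  aug_homog : ∀ l, aug (Pi.single l 1) ∈ gr (tw 0 l)
  d_homog : ∀ i l l', homogZ k (d i (Pi.single l 1) l') (tw (i + 1) l - tw i l')

/-- The Castelnuovo–Mumford regularity of a (finitely generated) graded module over a
polynomial ring: the least `r` such that `M` admits a graded free resolution with all
twists in homological degree `i` at most `r + i`.  (By minimal free resolutions, this
agrees with `max {aⁱ(M) + i}`.) -/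
def regM (σ : Type) (M : Type) [AddCommGroup M] [Module (MvPolynomial σ k) M]
    (gr : ℤ → AddSubgroup M) : ℤ :=
  sInf {r : ℤ | ∃ F : GradedFreeRes k σ M gr, ∀ i (l : Fin (F.rk i)), F.tw i l - (i : ℤ) ≤ r}

/-- Depth of the quotient ring `P/Q` as a module over `P`. -/
def depthQuot {σ : Type} (Q : Ideal (MvPolynomial σ k)) : ℕ :=
  depthM k (ModuleCat.of (MvPolynomial σ k) (MvPolynomial σ k ⧸ Q))

/-- Depth of the subquotient `p/q` as a module over the polynomial ring. -/
def depthSubQuot {σ : Type} (p q : Ideal (MvPolynomial σ k)) : ℕ :=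
  depthM k (ModuleCat.of (MvPolynomial σ k) (subQuot k p q))

/-- Depth of an ideal `p` as a module over the polynomial ring. -/
def depthIdeal {σ : Type} (p : Ideal (MvPolynomial σ k)) : ℕ :=
  depthM k (ModuleCat.of (MvPolynomial σ k) ↥p)

/-- Regularity of the quotient ring `P/Q`. -/
def regQuot {σ : Type} (Q : Ideal (MvPolynomial σ k)) : ℤ :=
  regM k σ (MvPolynomial σ k ⧸ Q) (quotGr k Q)

/-- Regularity of the subquotient `p/q`. -/
def regSubQuot {σ : Type} (p q : Ideal (MvPolynomial σ k)) : ℤ :=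
  regM k σ (subQuot k p q) (subQuotGr k p q)

/-- Regularity of an ideal `p`, viewed as a graded module. -/
def regIdeal {σ : Type} (p : Ideal (MvPolynomial σ k)) : ℤ :=
  regM k σ (↥p) (idealGr k p)

/-- A homogeneous ideal: one containing all homogeneous components of its elements. -/
def IsHomogeneousIdeal {σ : Type} (I : Ideal (MvPolynomial σ k)) : Prop :=
  ∀ f ∈ I, ∀ m : ℕ, MvPolynomial.homogeneousComponent m f ∈ I

/-- A monomial ideal. -/
def IsMonomialIdeal {σ : Type} (I : Ideal (MvPolynomial σ k)) : Prop :=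
  ∃ S : Set (σ →₀ ℕ), I = Ideal.span ((fun a => MvPolynomial.monomial a (1 : k)) '' S)

/-- A squarefree monomial ideal. -/
def IsSquarefreeMonomialIdeal {σ : Type} (I : Ideal (MvPolynomial σ k)) : Prop :=
  ∃ S : Set (σ →₀ ℕ), (∀ a ∈ S, ∀ x, a x ≤ 1) ∧
    I = Ideal.span ((fun a => MvPolynomial.monomial a (1 : k)) '' S)


/-- The quotient ring `P/Q` is Cohen–Macaulay: its depth equals its Krull dimension. -/
def IsCMQuot {σ : Type} (Q : Ideal (MvPolynomial σ k)) : Prop :=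
  (depthQuot k Q : WithBot (WithTop ℕ)) = ringKrullDim (MvPolynomial σ k ⧸ Q)

/-- An isomorphism of graded modules: a linear isomorphism matching up the gradings. -/
def GradedIso {P : Type} [CommRing P] {M N : Type} [AddCommGroup M] [Module P M]
    [AddCommGroup N] [Module P N] (grM : ℤ → AddSubgroup M) (grN : ℤ → AddSubgroup N) :
    Prop :=
  ∃ e : M ≃ₗ[P] N, ∀ t, (grM t).map e.toLinearMap.toAddMonoidHom = grN t

/-- `gr` is an (internal, ℤ-) grading of the module `M` over a polynomial ring,
compatible with the standard grading of the polynomial ring. -/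
def IsGrading (σ : Type) {M : Type} [AddCommGroup M] [Module (MvPolynomial σ k) M]
    (gr : ℤ → AddSubgroup M) : Prop :=
  DirectSum.IsInternal (fun t : ℤ => gr t) ∧
    ∀ (p : MvPolynomial σ k) (d : ℕ) (t : ℤ) (m : M), p.IsHomogeneous d → m ∈ gr t →
      p • m ∈ gr (t + d)

/-- The polynomial ring `A = k[x_1,…,x_r]`. -/
abbrev PA (r : ℕ) : Type := MvPolynomial (Fin r) k

/-- The polynomial ring `B = k[y_1,…,y_s]`. -/
abbrev PB (s : ℕ) : Type := MvPolynomial (Fin s) k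

/-- The polynomial ring `R = k[x_1,…,x_r,y_1,…,y_s]`. -/
abbrev PR (r s : ℕ) : Type := MvPolynomial (Fin r ⊕ Fin s) k

/-- The extension of an ideal `I ⊆ A` to `R`. -/
def extA {r s : ℕ} (I : Ideal (PA k r)) : Ideal (PR k r s) :=
  I.map (MvPolynomial.rename (Sum.inl : Fin r → Fin r ⊕ Fin s))

/-- The extension of an ideal `J ⊆ B` to `R`. -/
def extB {r s : ℕ} (J : Ideal (PB k s)) : Ideal (PR k r s) :=
  J.map (MvPolynomial.rename (Sum.inr : Fin s → Fin r ⊕ Fin s))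

/-- The ideal `I + J ⊆ R`. -/
def sumIJ {r s : ℕ} (I : Ideal (PA k r)) (J : Ideal (PB k s)) : Ideal (PR k r s) :=
  extA k I + extB k J

end PaperHTT

end

open scoped TensorProduct

namespace PaperHTT

attribute [local instance] MvPolynomial.gradedAlgebra

section Homogeneous

variable {k : Type} [Field k] {σ τ : Type}

lemma isHomogeneousIdeal_iff (I : Ideal (MvPolynomial σ k)) :
    IsHomogeneousIdeal k I ↔ I.IsHomogeneous (homogeneousSubmodule σ k) :=
  ⟨fun h m f hf => by
    have := h f hf m
    rwa [← decomposition.decompose'_apply] at this, fun h f hf m => by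
    rw [← decomposition.decompose'_apply]
    exact h m hf⟩

lemma IsHomogeneousIdeal.mul {I J : Ideal (MvPolynomial σ k)} (hI : IsHomogeneousIdeal k I)
    (hJ : IsHomogeneousIdeal k J) : IsHomogeneousIdeal k (I * J) := by
  rw [isHomogeneousIdeal_iff] at *
  exact hI.mul hJ

lemma IsHomogeneousIdeal.pow {I : Ideal (MvPolynomial σ k)} (hI : IsHomogeneousIdeal k I)
    (n : ℕ) : IsHomogeneousIdeal k (I ^ n) := by
  induction n with
  | zero => exact fun f _ m => by simp
  | succ n ih => exact pow_succ I n ▸ ih.mul hI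

lemma IsHomogeneousIdeal.sum {ι : Type*} (s : Finset ι) {I : ι → Ideal (MvPolynomial σ k)}
    (hI : ∀ i ∈ s, IsHomogeneousIdeal k (I i)) : IsHomogeneousIdeal k (∑ i ∈ s, I i) := by
  refine Finset.sum_induction I (IsHomogeneousIdeal k) (fun a b ha hb => ?_) ?_ hI
  · rw [isHomogeneousIdeal_iff] at *
    exact ha.sup hb
  · exact (isHomogeneousIdeal_iff _).2 (Ideal.IsHomogeneous.bot _)

lemma IsHomogeneousIdeal.map_rename {I : Ideal (MvPolynomial σ k)}
    (hI : IsHomogeneousIdeal k I) (g : σ → τ) :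
    IsHomogeneousIdeal k (I.map (rename g : MvPolynomial σ k →ₐ[k] MvPolynomial τ k)) := by
  have h : I.map (rename g : MvPolynomial σ k →ₐ[k] MvPolynomial τ k) =
      Ideal.span (rename g '' {f | f ∈ I ∧ ∃ m, f.IsHomogeneous m}) := by
    refine le_antisymm (Ideal.map_le_iff_le_comap.2 fun f hf => ?_)
      (Ideal.span_mono (Set.image_mono fun f hf => hf.1))
    rw [Ideal.mem_comap, ← sum_homogeneousComponent f, map_sum]
    exact Ideal.sum_mem _ fun m _ => Ideal.subset_span
      ⟨_, ⟨hI f hf m, m, homogeneousComponent_isHomogeneous m f⟩, rfl⟩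
  rw [h, isHomogeneousIdeal_iff]
  refine Ideal.homogeneous_span _ _ ?_
  rintro _ ⟨f, ⟨-, m, hm⟩, rfl⟩
  exact ⟨m, hm.rename_isHomogeneous⟩

/-- A homogeneous element of a sum of homogeneous ideals splits into homogeneous summands. -/
lemma exists_add_eq_of_homogZ {p q : Ideal (MvPolynomial σ k)} (hp : IsHomogeneousIdeal k p)
    (hq : IsHomogeneousIdeal k q) {f : MvPolynomial σ k} {t : ℤ} (hf : f ∈ p ⊔ q)
    (ht : homogZ k f t) : ∃ g ∈ p, ∃ h ∈ q, homogZ k g t ∧ g + h = f := by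
  rcases ht with rfl | ⟨ht0, ht⟩
  · exact ⟨0, p.zero_mem, 0, q.zero_mem, Or.inl rfl, add_zero 0⟩
  · obtain ⟨g, hg, h, hh, rfl⟩ := Submodule.mem_sup.1 hf
    refine ⟨_, hp g hg t.toNat, _, hq h hh t.toNat,
      Or.inr ⟨ht0, homogeneousComponent_isHomogeneous _ _⟩, ?_⟩
    rw [← map_add, homogeneousComponent_of_mem ht, if_pos rfl]

/-- The second isomorphism theorem for homogeneous ideals. -/
theorem gradedIso_sup_quot {p q : Ideal (MvPolynomial σ k)} (hp : IsHomogeneousIdeal k p)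
    (hq : IsHomogeneousIdeal k q) :
    GradedIso (P := MvPolynomial σ k) (subQuotGr k (p ⊔ q) q) (subQuotGr k p (p ⊓ q)) := by
  let φ : subQuot k p (p ⊓ q) ≃ₗ[MvPolynomial σ k] subQuot k (p ⊔ q) q :=
    LinearMap.quotientInfEquivSupQuotient p q
  have hφ (x : p) : φ (Submodule.Quotient.mk x) =
      Submodule.Quotient.mk (Submodule.inclusion le_sup_left x) := rfl
  refine ⟨φ.symm, fun t => ?_⟩
  rw [subQuotGr, AddMonoidHom.map_closure, subQuotGr]
  congr 1
  ext y
  constructor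
  · rintro ⟨_, ⟨f, hf, rfl⟩, rfl⟩
    obtain ⟨g, hg, h, hh, hgt, hgh⟩ := exists_add_eq_of_homogZ hp hq f.2 hf
    refine ⟨⟨g, hg⟩, hgt, φ.symm_apply_eq.2 ?_⟩
    rw [hφ]
    refine (Submodule.Quotient.eq _).2 ?_
    simpa [← hgh] using hh
  · rintro ⟨f, hf, rfl⟩
    exact ⟨_, ⟨Submodule.inclusion le_sup_left f, hf, rfl⟩, φ.symm_apply_eq.2 (hφ f).symm⟩

end Homogeneous

section Disjoint

variable {k : Type} [Field k] {r s : ℕ}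

lemma tensorEquivSum_tmul (p : PA k r) (q : PB k s) :
    tensorEquivSum k (Fin r) (Fin s) k (p ⊗ₜ q) = rename Sum.inl p * rename Sum.inr q := by
  have hl : ((tensorEquivSum k (Fin r) (Fin s) k).toAlgHom.comp
      Algebra.TensorProduct.includeLeft) = rename Sum.inl := by
    ext; simp
  have hr : ((tensorEquivSum k (Fin r) (Fin s) k).toAlgHom.comp
      Algebra.TensorProduct.includeRight) = rename Sum.inr := by
    ext; simp
  rw [← hl, ← hr, ← one_mul q, ← mul_one p, ← Algebra.TensorProduct.tmul_mul_tmul, map_mul]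
  simp

/-- A property of the elements of an extended ideal may be checked on products of a
generator with polynomials in separated variables. -/
lemma map_induction {S : Type*} [CommRing S] {F : Type*} [FunLike F S (PR k r s)]
    [RingHomClass F S (PR k r s)] (φ : F) (a : Ideal S) (M : AddSubgroup (PR k r s))
    (h : ∀ x ∈ a, ∀ (p : PA k r) (q : PB k s),
      rename Sum.inl p * rename Sum.inr q * φ x ∈ M) : (a.map φ : Set (PR k r s)) ⊆ M := by
  intro f hf
  suffices ∀ g : PR k r s, g * f ∈ M by simpa using this 1
  refine Submodule.span_induction ?_ ?_ ?_ ?_ hf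
  · rintro _ ⟨x, hx, rfl⟩ g
    obtain ⟨t, rfl⟩ := (tensorEquivSum k (Fin r) (Fin s) k).surjective g
    induction t using TensorProduct.induction_on with
    | zero => simp [M.zero_mem]
    | tmul p q => exact tensorEquivSum_tmul p q ▸ h x hx p q
    | add u v hu hv => simpa only [map_add, add_mul] using M.add_mem hu hv
  · simp [M.zero_mem]
  · exact fun u v _ _ hu hv g => by simpa only [mul_add] using M.add_mem (hu g) (hv g)
  · exact fun c u _ hu g => by simpa only [smul_eq_mul, mul_assoc] using hu (g * c)

/-- Ideals extended from disjoint sets of variables intersect in their product. -/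
theorem extA_inf_extB (a : Ideal (PA k r)) (b : Ideal (PB k s)) :
    (extA k a ⊓ extB k b : Ideal (PR k r s)) = extA k a * extB k b := by
  refine le_antisymm ?_ Ideal.mul_le_inf
  obtain ⟨π, hπ⟩ := (b.restrictScalars k).subtype.exists_leftInverse_of_injective
    (Submodule.ker_subtype _)
  have hπ' (q : PB k s) (hq : q ∈ b) : (π q : PB k s) = q :=
    congrArg Subtype.val (LinearMap.congr_fun hπ ⟨q, hq⟩)
  let e := (tensorEquivSum k (Fin r) (Fin s) k).toLinearEquiv
  let ρ : PR k r s →ₗ[k] PR k r s := e.toLinearMap ∘ₗ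
    LinearMap.lTensor (PA k r) ((b.restrictScalars k).subtype ∘ₗ π) ∘ₗ e.symm.toLinearMap
  have hρ (p : PA k r) (q : PB k s) : ρ (rename Sum.inl p * rename Sum.inr q) =
      rename Sum.inl p * rename Sum.inr (π q : PB k s) := by
    rw [← tensorEquivSum_tmul, ← tensorEquivSum_tmul]
    change e (LinearMap.lTensor _ _ (e.symm (e _))) = _
    rw [e.symm_apply_apply]
    rfl
  rintro f ⟨hfa, hfb⟩
  have h1 : ρ f = f := by
    have := map_induction (rename Sum.inr) b (ρ - LinearMap.id).toAddMonoidHom.ker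
      (fun x hx p q => ?_) hfb
    · simpa [sub_eq_zero] using this
    · have : ρ (rename Sum.inl p * rename Sum.inr q * rename Sum.inr x) =
          rename Sum.inl p * rename Sum.inr q * rename Sum.inr x := by
        rw [mul_assoc, ← map_mul, hρ, hπ' _ (b.mul_mem_left q hx)]
      simpa [sub_eq_zero] using this
  have h2 : ρ f ∈ extA k a * extB k b := by
    refine map_induction (rename Sum.inl) a
      ((extA k a * extB k b : Ideal (PR k r s)).toAddSubgroup.comap ρ.toAddMonoidHom)
      (fun x hx p q => ?_) hfa
    change ρ _ ∈ extA k a * extB k b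
    rw [mul_right_comm, ← map_mul, hρ]
    exact Ideal.mul_mem_mul (Ideal.mem_map_of_mem _ (a.mul_mem_left p hx))
      (Ideal.mem_map_of_mem _ (π q).2)
  exact h1 ▸ h2

lemma extA_pow_inf_extB_pow (I : Ideal (PA k r)) (J : Ideal (PB k s)) (m n : ℕ) :
    (extA k I ^ m ⊓ extB k J ^ n : Ideal (PR k r s)) = extA k I ^ m * extB k J ^ n := by
  simpa only [extA, extB, Ideal.map_pow] using extA_inf_extB (I ^ m) (J ^ n)

end Disjoint

end PaperHTT

open PaperHTT in
/-- Lemma 2.2: with `Q_i = ∑_(j=0)^i I^(n-j) J^j`, for `1 ≤ i ≤ n` there is an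
isomorphism of graded `R`-modules `Q_i/Q_(i-1) ≅ I^(n-i) J^i / I^(n-i+1) J^i`. -/
theorem filtration_quot_iso
    (k : Type) [Field k] (r s : ℕ)
    (I : Ideal (PA k r)) (J : Ideal (PB k s))
    (hI0 : I ≠ ⊥) (hI1 : I ≠ ⊤) (hIh : IsHomogeneousIdeal k I)
    (hJ0 : J ≠ ⊥) (hJ1 : J ≠ ⊤) (hJh : IsHomogeneousIdeal k J)
    (n i : ℕ) (hn : 1 ≤ n) (hi1 : 1 ≤ i) (hin : i ≤ n) :
    GradedIso (P := PR k r s)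
      (subQuotGr k
        (∑ jj ∈ Finset.range (i + 1), (extA k I : Ideal (PR k r s)) ^ (n - jj) * extB k J ^ jj)
        (∑ jj ∈ Finset.range i, (extA k I : Ideal (PR k r s)) ^ (n - jj) * extB k J ^ jj))
      (subQuotGr k ((extA k I : Ideal (PR k r s)) ^ (n - i) * extB k J ^ i)
        ((extA k I : Ideal (PR k r s)) ^ (n - i + 1) * extB k J ^ i)) := by
  have hA : IsHomogeneousIdeal k (extA k I : Ideal (PR k r s)) := hIh.map_rename _
  have hB : IsHomogeneousIdeal k (extB k J : Ideal (PR k r s)) := hJh.map_rename _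
  have hinf : (extA k I : Ideal (PR k r s)) ^ (n - i + 1) * extB k J ^ i =
      (extA k I ^ (n - i) * extB k J ^ i) ⊓
        ∑ jj ∈ Finset.range i, (extA k I : Ideal (PR k r s)) ^ (n - jj) * extB k J ^ jj := by
    apply le_antisymm
    · refine le_inf (Ideal.mul_mono_left (Ideal.pow_le_pow_right (Nat.le_succ _))) ?_
      rw [Ideal.sum_eq_sup]
      refine le_trans ?_ (Finset.le_sup (Finset.mem_range.2 (Nat.sub_lt hi1 one_pos)))
      rw [show n - (i - 1) = n - i + 1 by lia]
      exact Ideal.mul_mono_right (Ideal.pow_le_pow_right (Nat.sub_le _ _))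
    · rw [← extA_pow_inf_extB_pow I J (n - i + 1), inf_comm]
      refine inf_le_inf ?_ Ideal.mul_le_right
      rw [Ideal.sum_eq_sup]
      refine Finset.sup_le fun j hj => Ideal.mul_le_left.trans (Ideal.pow_le_pow_right ?_)
      have := Finset.mem_range.1 hj
      lia
  rw [hinf, Finset.sum_range_succ, add_comm]
  exact gradedIso_sup_quot ((hA.pow _).mul (hB.pow _))
    (IsHomogeneousIdeal.sum _ fun j _ => (hA.pow _).mul (hB.pow _))
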